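/- arXiv:2109.12206 — 4 statements merged into one kernel-verified Lean document; each statement's English description precedes it below -/
import Mathlib

section
/- Let B ∈ ℝ^{n×n} be symmetric positive definite, g ∈ ℝⁿ, y the solution of B y = g, and p a real polynomial. Set v = p(B) g. Then ‖y − v‖_B ≤ (max over eigenvalues t of B of |1 − t·p(t)|) · ‖y‖_B. -/
open Matrix BigOperators

/-- The norm induced by a (s.p.d.) matrix `B`: `‖x‖_B = (xᵀ B x)^{1/2}`. -/
noncomputable def Bnorm {n : ℕ} (B : Matrix (Fin n) (Fin n) ℝ) (x : Fin n → ℝ) : ℝ :=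
  Real.sqrt (x ⬝ᵥ B.mulVec x)

theorem Matrix.IsHermitian.star_eigenvectorUnitary_mulVec_mulVec {n : ℕ}
    {B : Matrix (Fin n) (Fin n) ℝ} (hB : B.IsHermitian) (x : Fin n → ℝ) (i : Fin n) :
    (star (hB.eigenvectorUnitary : Matrix (Fin n) (Fin n) ℝ) *ᵥ (B *ᵥ x)) i =
      hB.eigenvalues i *
        (star (hB.eigenvectorUnitary : Matrix (Fin n) (Fin n) ℝ) *ᵥ x) i := by
  set U : Matrix (Fin n) (Fin n) ℝ := (hB.eigenvectorUnitary : Matrix (Fin n) (Fin n) ℝ)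
  have hUU : star U * U = 1 := Unitary.coe_star_mul_self hB.eigenvectorUnitary
  have hs : B = U * diagonal hB.eigenvalues * star U := by
    simpa [Unitary.conjStarAlgAut_apply, Function.comp_def] using hB.spectral_theorem
  have h : star U * B = diagonal hB.eigenvalues * star U := by
    conv_lhs => rw [hs]
    rw [Matrix.mul_assoc, ← Matrix.mul_assoc, hUU, ← Matrix.mul_assoc, Matrix.one_mul]
  rw [mulVec_mulVec, h, ← mulVec_mulVec, mulVec_diagonal]

theorem Matrix.IsHermitian.star_eigenvectorUnitary_mulVec_aeval_mulVec {n : ℕ}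
    {B : Matrix (Fin n) (Fin n) ℝ} (hB : B.IsHermitian) (q : Polynomial ℝ) (x : Fin n → ℝ)
    (i : Fin n) :
    (star (hB.eigenvectorUnitary : Matrix (Fin n) (Fin n) ℝ) *ᵥ
        (Polynomial.aeval B q *ᵥ x)) i =
      q.eval (hB.eigenvalues i) *
        (star (hB.eigenvectorUnitary : Matrix (Fin n) (Fin n) ℝ) *ᵥ x) i := by
  induction q using Polynomial.induction_on generalizing x with
  | C a => simp [Algebra.algebraMap_eq_smul_one, smul_mulVec, mulVec_smul]
  | add p q hp hq =>
    rw [map_add, add_mulVec, mulVec_add, Pi.add_apply, hp, hq, Polynomial.eval_add, add_mul]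
  | monomial k a ih =>
    rw [pow_succ, ← mul_assoc, map_mul, Polynomial.aeval_X, ← mulVec_mulVec, ih,
      hB.star_eigenvectorUnitary_mulVec_mulVec, Polynomial.eval_mul (q := Polynomial.X),
      Polynomial.eval_X, mul_assoc]

theorem Matrix.IsHermitian.dotProduct_mulVec_eq_sum_eigenvalues {n : ℕ}
    {B : Matrix (Fin n) (Fin n) ℝ} (hB : B.IsHermitian) (x : Fin n → ℝ) :
    x ⬝ᵥ B *ᵥ x = ∑ i, hB.eigenvalues i *
      (star (hB.eigenvectorUnitary : Matrix (Fin n) (Fin n) ℝ) *ᵥ x) i ^ 2 := by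
  set U : Matrix (Fin n) (Fin n) ℝ := (hB.eigenvectorUnitary : Matrix (Fin n) (Fin n) ℝ)
  have hUU : U * star U = 1 := Unitary.coe_mul_star_self hB.eigenvectorUnitary
  have h : x ⬝ᵥ B *ᵥ x = (star U *ᵥ x) ⬝ᵥ (star U *ᵥ (B *ᵥ x)) := by
    have ht : star U *ᵥ x = x ᵥ* U := by
      rw [star_eq_conjTranspose, conjTranspose_eq_transpose_of_trivial, mulVec_transpose]
    rw [ht, ← dotProduct_mulVec, mulVec_mulVec, hUU, one_mulVec]
  rw [h, dotProduct]
  refine Finset.sum_congr rfl fun i _ => ?_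
  rw [hB.star_eigenvectorUnitary_mulVec_mulVec]
  ring

/-- for `B` s.p.d., `B y = g`, `v = p(B) g`, we have
`‖y − v‖_B ≤ max_{t ∈ Λ(B)} |1 − t p(t)| · ‖y‖_B`. -/
theorem stmt3 {n : ℕ} (hn : 0 < n) (B : Matrix (Fin n) (Fin n) ℝ) (hB : B.PosDef)
    (g y : Fin n → ℝ) (hy : B.mulVec y = g)
    (p : Polynomial ℝ) (v : Fin n → ℝ)
    (hv : v = (Polynomial.aeval B p).mulVec g)
    (he : (Finset.univ : Finset (Fin n)).Nonempty) :
    Bnorm B (y - v) ≤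
      (Finset.univ.sup' he fun i =>
        |1 - hB.1.eigenvalues i * p.eval (hB.1.eigenvalues i)|) * Bnorm B y := by
  subst hy hv
  set M := Finset.univ.sup' he fun i =>
    |1 - hB.1.eigenvalues i * p.eval (hB.1.eigenvalues i)|
  have hle (i : Fin n) : |1 - hB.1.eigenvalues i * p.eval (hB.1.eigenvalues i)| ≤ M :=
    Finset.le_sup' (fun i => |1 - hB.1.eigenvalues i * p.eval (hB.1.eigenvalues i)|)
      (Finset.mem_univ i)
  have hM0 : 0 ≤ M := (abs_nonneg _).trans (hle ⟨0, hn⟩)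
  unfold Bnorm
  rw [← Real.sqrt_sq hM0, ← Real.sqrt_mul (sq_nonneg M)]
  apply Real.sqrt_le_sqrt
  rw [hB.1.dotProduct_mulVec_eq_sum_eigenvalues, hB.1.dotProduct_mulVec_eq_sum_eigenvalues,
    Finset.mul_sum]
  refine Finset.sum_le_sum fun i _ => ?_
  rw [mulVec_sub, Pi.sub_apply, hB.1.star_eigenvectorUnitary_mulVec_aeval_mulVec,
    hB.1.star_eigenvectorUnitary_mulVec_mulVec]
  have hsq := sq_le_sq' (abs_le.mp (hle i)).1 (abs_le.mp (hle i)).2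
  set c := (star (hB.1.eigenvectorUnitary : Matrix (Fin n) (Fin n) ℝ) *ᵥ y) i
  calc _ = (1 - hB.1.eigenvalues i * p.eval (hB.1.eigenvalues i)) ^ 2 *
        (hB.1.eigenvalues i * c ^ 2) := by ring
    _ ≤ _ := mul_le_mul_of_nonneg_right hsq
        (mul_nonneg (hB.eigenvalues_pos i).le (sq_nonneg c))
end

section
/- Let 0 < λ_min < λ_max, κ = λ_max/λ_min, and j ∈ ℕ, j ≥ 1. Define the translated and scaled Chebyshev polynomial q*_j(t) = T_j((λ_max + λ_min − 2t)/(λ_max − λ_min)) / T_j((λ_max + λ_min)/(λ_max − λ_min)), where T_j is the j-th Chebyshev polynomial of the first kind. Then q*_j(0) = 1 and for every t ∈ [λ_min, λ_max], |q*_j(t)| ≤ 2 ((√κ − 1)/(√κ + 1))^j. -/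
open Polynomial

/-- Chebyshev polynomials at the Joukowski transform of `r > 0` are at least `r ^ n / 2`. -/
theorem pow_div_two_le_eval_T_joukowski {r : ℝ} (hr : 0 < r) (n : ℕ) :
    r ^ n / 2 ≤ (Polynomial.Chebyshev.T ℝ n).eval ((r + r⁻¹) / 2) := by
  have hexp : Real.exp (n * Real.log r) = r ^ n := by
    rw [Real.exp_nat_mul, Real.exp_log hr]
  rw [← Real.cosh_log hr, Polynomial.Chebyshev.T_real_cosh, Real.cosh_eq]
  push_cast
  rw [hexp]
  linarith [Real.exp_pos (-(n * Real.log r))]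

/-- the translated and scaled Chebyshev polynomial
`q*_j(t) = T_j((λmax+λmin−2t)/(λmax−λmin)) / T_j((λmax+λmin)/(λmax−λmin))`
satisfies `q*_j(0) = 1` and `|q*_j(t)| ≤ 2((√κ−1)/(√κ+1))^j` on `[λmin, λmax]`,
where `κ = λmax/λmin`. -/
theorem stmt4 (lmin lmax : ℝ) (hmin : 0 < lmin) (hlt : lmin < lmax)
    (κ : ℝ) (hκ : κ = lmax / lmin) (j : ℕ) (hj : 1 ≤ j)
    (q : ℝ → ℝ)
    (hq : ∀ t : ℝ, q t =
      (Polynomial.Chebyshev.T ℝ j).eval ((lmax + lmin - 2 * t) / (lmax - lmin)) /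
      (Polynomial.Chebyshev.T ℝ j).eval ((lmax + lmin) / (lmax - lmin))) :
    q 0 = 1 ∧ ∀ t ∈ Set.Icc lmin lmax,
      |q t| ≤ 2 * ((Real.sqrt κ - 1) / (Real.sqrt κ + 1)) ^ j := by
  have hd : 0 < lmax - lmin := sub_pos.mpr hlt
  have hT : 1 ≤ (Polynomial.Chebyshev.T ℝ j).eval ((lmax + lmin) / (lmax - lmin)) :=
    Polynomial.Chebyshev.one_le_eval_T_real j ((one_le_div hd).mpr (by linarith))
  refine ⟨?_, fun t ht => ?_⟩
  · rw [hq, mul_zero, sub_zero, div_self (by linarith)]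
  have hκ1 : 1 < κ := by rw [hκ]; exact (one_lt_div hmin).mpr hlt
  have hs1 : 1 < √κ := Real.lt_sqrt_of_sq_lt (by simpa using hκ1)
  have hs2 : √κ ^ 2 = κ := Real.sq_sqrt (by linarith)
  set s := √κ
  have hsub : 0 < s - 1 := by linarith
  have hadd : 0 < s + 1 := by linarith
  have hmax : lmax = s ^ 2 * lmin := by rw [hs2, hκ]; field_simp
  have harg : ((s + 1) / (s - 1) + ((s + 1) / (s - 1))⁻¹) / 2 =
      (lmax + lmin) / (lmax - lmin) := by
    rw [div_eq_div_iff two_ne_zero hd.ne', inv_div, hmax]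
    field_simp
    ring
  have hlow := pow_div_two_le_eval_T_joukowski (div_pos hadd hsub) j
  rw [harg] at hlow
  have hnum : |(Polynomial.Chebyshev.T ℝ j).eval ((lmax + lmin - 2 * t) / (lmax - lmin))| ≤ 1 := by
    apply Polynomial.Chebyshev.abs_eval_T_real_le_one
    rw [abs_le, le_div_iff₀ hd, div_le_iff₀ hd]
    constructor <;> linarith [ht.1, ht.2]
  rw [hq, abs_div, abs_of_pos (zero_lt_one.trans_le hT)]
  calc _ ≤ 1 / (((s + 1) / (s - 1)) ^ j / 2) :=
        div_le_div₀ zero_le_one hnum (by positivity) hlow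
    _ = 2 * ((s - 1) / (s + 1)) ^ j := by
        rw [one_div_div, ← inv_div (s + 1) (s - 1), inv_pow, div_eq_mul_inv]
end

section
/- Let A₁,…,A_s ∈ ℝ^{n×n}, A(σ) = Σ_{i=1}^s σ_i A_i, and let L be the linearisation function of A. Then for every k ∈ ℕ, k ≥ 1, every b ∈ ℝⁿ, and every σ ∈ ℝ^s, one has A(σ)^k b = L^k(b) σ^{⊗k}, where L^k(b) ∈ ℝ^{n × s^k} is the k-fold application of L to b and σ^{⊗k} ∈ ℝ^{s^k} is the k-fold Kronecker product of σ with itself. -/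
open Matrix BigOperators

/-- Index type for the `k`-fold Kronecker power of a vector in `ℝ^s`
(`kronIdx s k` has cardinality `s^k`). -/
abbrev kronIdx (s : ℕ) : ℕ → Type
  | 0 => Unit
  | k + 1 => Fin s × kronIdx s k

instance kronIdxFintype (s : ℕ) : ∀ k, Fintype (kronIdx s k)
  | 0 => inferInstanceAs (Fintype Unit)
  | k + 1 => @instFintypeProd _ _ _ (kronIdxFintype s k)

/-- The `k`-fold Kronecker product `σ^{⊗k}` of `σ ∈ ℝ^s` with itself:
`σ^{⊗1} = σ` and `σ^{⊗(k+1)} = σ ⊗ σ^{⊗k}`. -/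
def kronPow {s : ℕ} (σ : Fin s → ℝ) : ∀ k, kronIdx s k → ℝ
  | 0, _ => 1
  | k + 1, p => σ p.1 * kronPow σ k p.2

/-- The linearisation function `L` of `A(σ) = Σ σᵢ Aᵢ`, mapping
`C ∈ ℝ^{n×m}` to the block matrix `[A₁C ⋯ A_sC] ∈ ℝ^{n×sm}`. -/
def linFun {n s : ℕ} (A : Fin s → Matrix (Fin n) (Fin n) ℝ) {m : Type*}
    (C : Matrix (Fin n) m ℝ) : Matrix (Fin n) (Fin s × m) ℝ :=
  Matrix.of fun r p => (A p.1 * C) r p.2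

/-- `Lpow A b k = L^k(b)`, the `k`-fold application of the linearisation
function `L` to `b ∈ ℝⁿ` (viewed as an `n×1` matrix). -/
def Lpow {n s : ℕ} (A : Fin s → Matrix (Fin n) (Fin n) ℝ) (b : Fin n → ℝ) :
    ∀ k, Matrix (Fin n) (kronIdx s k) ℝ
  | 0 => Matrix.of fun r _ => b r
  | k + 1 => linFun A (Lpow A b k)

/-- Multiplying `L(C)` by a Kronecker product `σ ⊗ v` gives `A(σ) (C v)`. -/
theorem linFun_mulVec_kronecker {n s : ℕ} (A : Fin s → Matrix (Fin n) (Fin n) ℝ)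
    {m : Type*} [Fintype m] (C : Matrix (Fin n) m ℝ) (σ : Fin s → ℝ) (v : m → ℝ) :
    (linFun A C).mulVec (fun p => σ p.1 * v p.2) = (∑ i, σ i • A i).mulVec (C.mulVec v) := by
  rw [Matrix.sum_mulVec]
  ext r
  simp only [Finset.sum_apply, Matrix.mulVec_mulVec, Matrix.smul_mul, Matrix.mulVec, dotProduct,
    linFun, Matrix.of_apply, Fintype.sum_prod_type, Matrix.smul_apply, smul_eq_mul]
  exact Finset.sum_congr rfl fun i _ => Finset.sum_congr rfl fun j _ => by ring

/-- `A(σ)^k b = L^k(b) σ^{⊗k}` for all `k ≥ 1`. -/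
theorem stmt6 {n s : ℕ} (A : Fin s → Matrix (Fin n) (Fin n) ℝ)
    (b : Fin n → ℝ) (σ : Fin s → ℝ) (k : ℕ) (hk : 1 ≤ k) :
    ((∑ i, σ i • A i) ^ k).mulVec b = (Lpow A b k).mulVec (kronPow σ k) := by
  clear hk
  induction k with
  | zero =>
    ext r
    rw [pow_zero, Matrix.one_mulVec]
    exact ((Fintype.sum_unique (ι := Unit) fun _ => b r * 1).trans (mul_one _)).symm
  | succ k ih =>
    rw [pow_succ', ← Matrix.mulVec_mulVec, ih]
    exact (linFun_mulVec_kronecker A (Lpow A b k) σ (kronPow σ k)).symm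
end

section
/- Let A₁,…,A_s ∈ ℝ^{n×n}, A(σ) = Σ_{i=1}^s σ_i A_i, b ∈ ℝⁿ, and let L be the linearisation function of A. For j ∈ ℕ, j ≥ 1, define the compound Krylov subspace CK_j(A,b) = span{b} + Σ_{k=1}^{j−1} (column space of L^k(b)). Then for every σ ∈ ℝ^s and every j ≥ 1, the Krylov subspace K_j(A(σ), b) = span{b, A(σ)b, …, A(σ)^{j−1} b} is contained in CK_j(A,b). -/
open Matrix BigOperators

/-- The compound Krylov subspace
`CK_j(A,b) = span{b} + Σ_{k=1}^{j−1} colspace(L^k(b))`. -/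
noncomputable def CK {n s : ℕ} (A : Fin s → Matrix (Fin n) (Fin n) ℝ)
    (b : Fin n → ℝ) (j : ℕ) : Submodule ℝ (Fin n → ℝ) :=
  Submodule.span ℝ {b} ⊔ ⨆ k ∈ Finset.Icc 1 (j - 1), LinearMap.range (Lpow A b k).mulVecLin

theorem linFun_mulVec {n s : ℕ} (A : Fin s → Matrix (Fin n) (Fin n) ℝ) {m : Type*} [Fintype m]
    (C : Matrix (Fin n) m ℝ) (σ : Fin s → ℝ) (w : m → ℝ) :
    linFun A C *ᵥ (fun p => σ p.1 * w p.2) = (∑ i, σ i • A i) *ᵥ (C *ᵥ w) := by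
  rw [Matrix.mulVec_mulVec, Matrix.sum_mul]
  ext r
  simp only [Matrix.mulVec, dotProduct, linFun, Matrix.of_apply, Fintype.sum_prod_type,
    Matrix.sum_apply, Matrix.smul_mul, Matrix.smul_apply, smul_eq_mul, Finset.sum_mul]
  rw [Finset.sum_comm]
  exact Finset.sum_congr rfl fun j _ => Finset.sum_congr rfl fun i _ => by ring

theorem Lpow_mulVec_kronPow {n s : ℕ} (A : Fin s → Matrix (Fin n) (Fin n) ℝ) (b : Fin n → ℝ)
    (σ : Fin s → ℝ) (k : ℕ) :
    Lpow A b k *ᵥ kronPow σ k = ((∑ i, σ i • A i) ^ k) *ᵥ b := by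
  induction k with
  | zero =>
    rw [pow_zero, Matrix.one_mulVec]
    ext r
    change ∑ _u : Unit, b r * 1 = b r
    simp
  | succ k ih =>
    rw [pow_succ', ← Matrix.mulVec_mulVec, ← ih]
    exact linFun_mulVec A (Lpow A b k) σ (kronPow σ k)

/-- `K_j(A(σ),b) ⊆ CK_j(A,b)` for every `σ ∈ ℝ^s` and every `j ≥ 1`. -/
theorem stmt7 {n s : ℕ} (A : Fin s → Matrix (Fin n) (Fin n) ℝ) (b : Fin n → ℝ) :
    ∀ (σ : Fin s → ℝ) (j : ℕ), 1 ≤ j →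
      Submodule.span ℝ {v | ∃ k < j, v = ((∑ i, σ i • A i) ^ k).mulVec b} ≤ CK A b j := by
  intro σ j _
  rw [Submodule.span_le]
  rintro v ⟨k, hk, rfl⟩
  rcases Nat.eq_zero_or_pos k with rfl | hpos
  · rw [pow_zero, Matrix.one_mulVec]
    exact Submodule.mem_sup_left (Submodule.mem_span_singleton_self b)
  · refine Submodule.mem_sup_right (Submodule.mem_iSup_of_mem k
      (Submodule.mem_iSup_of_mem (Finset.mem_Icc.mpr ⟨hpos, by omega⟩) ?_))
    exact ⟨kronPow σ k, Lpow_mulVec_kronPow A b σ k⟩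
end
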